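/- arXiv:1812.05161 — 3 statements merged into one kernel-verified Lean document; each statement's English description precedes it below -/
import Mathlib

section
/- (Proposition 3.1, first part.) For the PBM model, i.i.d. queries q ~ Pr(Q), and under the condition that the query distribution is independent of the choice of ranker, the expectation of ĉ_k^{k,k'} satisfies E[ĉ_k^{k,k'}] = p_k · r_{k,k'}, where r_{k,k'} = E_q[ Σ_{d ∈ Ω(q)} 1[(q,d) ∈ S_{k,k'}] · rel(q,d) ]. Concretely: Σ_{i=1}^m Σ_{j=1}^{n_i} Σ_{q ∈ Q} Pr(q) Σ_{d ∈ Ω(q)} 1[(q,d) ∈ S_{k,k'}] · 1[rank(d | f_i(q)) = k] · (p_k · rel(q,d)) / w(q,d,k) = p_k · Σ_{q ∈ Q} Pr(q) Σ_{d ∈ Ω(q)} 1[(q,d) ∈ S_{k,k'}] · rel(q,d). -/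
/-- Real-valued indicator of a proposition. -/
noncomputable def indR (P : Prop) : ℝ := @ite ℝ P (Classical.propDecidable P) 1 0

/-- Membership of the pair `(q, d)` in the interventional set `S_{k,k'}`:
`d` is a candidate for `q`, some ranker puts `d` at rank `k` for `q`,
and some (other) ranker puts `d` at rank `k'` for `q`. -/
def Smem {Q D : Type*} (m : ℕ) (rnk : Fin m → Q → D → ℕ) (Ω : Q → Finset D)
    (q : Q) (d : D) (k k' : ℕ) : Prop :=
  d ∈ Ω q ∧ (∃ i : Fin m, rnk i q d = k) ∧ (∃ i' : Fin m, rnk i' q d = k')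

/-- The weight `w(q,d,k) = ∑_i n_i · 1[rank(d | f_i(q)) = k]`. -/
noncomputable def wgt {Q D : Type*} (m : ℕ) (n : Fin m → ℕ) (rnk : Fin m → Q → D → ℕ)
    (q : Q) (d : D) (k : ℕ) : ℝ :=
  ∑ i : Fin m, (n i : ℝ) * indR (rnk i q d = k)

theorem indR_nonneg (P : Prop) : 0 ≤ indR P := by
  unfold indR
  split_ifs <;> norm_num

theorem indR_of_true {P : Prop} (h : P) : indR P = 1 := if_pos h

theorem indR_of_false {P : Prop} (h : ¬P) : indR P = 0 := if_neg h

theorem wgt_pos {Q D : Type*} {m : ℕ} {n : Fin m → ℕ} {rnk : Fin m → Q → D → ℕ}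
    {q : Q} {d : D} {k : ℕ} (hn : ∀ i, 0 < n i) (h : ∃ i, rnk i q d = k) :
    0 < wgt m n rnk q d k := by
  obtain ⟨i, hi⟩ := h
  refine Finset.sum_pos' (fun j _ => mul_nonneg (Nat.cast_nonneg _) (indR_nonneg _))
    ⟨i, Finset.mem_univ i, ?_⟩
  rw [indR_of_true hi, mul_one]
  exact_mod_cast hn i

/-- Inverse-weighted contributions of all rankers to a pair in the interventional set add up
to its unweighted value. -/
theorem sum_indR_div_wgt {Q D : Type*} {m : ℕ} {n : Fin m → ℕ} {rnk : Fin m → Q → D → ℕ}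
    (Ω : Q → Finset D) (q : Q) (d : D) (k k' : ℕ) (hn : ∀ i, 0 < n i) (x : ℝ) :
    ∑ i : Fin m, (n i : ℝ) * (indR (Smem m rnk Ω q d k k') * indR (rnk i q d = k) * x /
        wgt m n rnk q d k) = indR (Smem m rnk Ω q d k k') * x := by
  by_cases h : Smem m rnk Ω q d k k'
  · have hw : wgt m n rnk q d k ≠ 0 := (wgt_pos hn h.2.1).ne'
    calc _ = (∑ i : Fin m, (n i : ℝ) * indR (rnk i q d = k)) * (x / wgt m n rnk q d k) := by
          rw [Finset.sum_mul]
          refine Finset.sum_congr rfl fun i _ => ?_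
          rw [indR_of_true h]
          ring
      _ = wgt m n rnk q d k * (x / wgt m n rnk q d k) := rfl
      _ = _ := by rw [mul_div_cancel₀ _ hw, indR_of_true h, one_mul]
  · simp [indR_of_false h]

/-- **Proposition 3.1, first part.** For the PBM model, i.i.d. queries
`q ~ Pr(Q)`, and under the condition that the query distribution is independent of the
choice of ranker (each ranker `f_i` processing `n i ≥ 1` queries), the expectation of
`ĉ_k^{k,k'}` satisfies `E[ĉ_k^{k,k'}] = p k · r_{k,k'}`, where
`r_{k,k'} = E_q[∑_{d ∈ Ω(q)} 1[(q,d) ∈ S_{k,k'}] · rel(q,d)]`.  Concretely, the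
expectation is obtained from the definition of `ĉ_k^{k,k'}` by replacing each click
indicator with the PBM click probability `p k · rel q d` and each logged query with the
expectation over `q ~ Pr(Q)`. -/
theorem prop_3_1_first_part {Q D : Type*} [Fintype Q]
    (Pr : Q → ℝ) (Ω : Q → Finset D) (rel : Q → D → ℝ)
    (m : ℕ) (n : Fin m → ℕ) (rnk : Fin m → Q → D → ℕ)
    (p : ℕ → ℝ) (k k' : ℕ)
    (hkk' : k ≠ k')
    (hrel : ∀ q d, rel q d = 0 ∨ rel q d = 1)
    (hp : ∀ j, 0 ≤ p j ∧ p j ≤ 1)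
    (hPr : ∀ q, 0 ≤ Pr q) (hPrsum : ∑ q : Q, Pr q = 1)
    (hn : ∀ i, 0 < n i) :
    ∑ i : Fin m, ∑ _j ∈ Finset.range (n i), ∑ q : Q, Pr q *
        ∑ d ∈ Ω q, indR (Smem m rnk Ω q d k k') * indR (rnk i q d = k) *
          (p k * rel q d) / wgt m n rnk q d k
      = p k * ∑ q : Q, Pr q *
          ∑ d ∈ Ω q, indR (Smem m rnk Ω q d k k') * rel q d := by
  simp only [Finset.sum_const, Finset.card_range, nsmul_eq_mul, Finset.mul_sum]
  rw [Finset.sum_comm]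
  refine Finset.sum_congr rfl fun q _ => ?_
  rw [Finset.sum_comm]
  refine Finset.sum_congr rfl fun d _ => ?_
  simp only [mul_left_comm _ (Pr q)]
  rw [← Finset.mul_sum, sum_indR_div_wgt Ω q d k k' hn]
  ring
end

section
/- (Relative propensity identity for interventional sets.) Under the hypotheses of Proposition 3.1, if the expected interventional-set relevance r_{k,k'} = E_q[ Σ_{d ∈ Ω(q)} 1[(q,d) ∈ S_{k,k'}] · rel(q,d) ] is strictly positive and p_{k'} > 0, then the relative propensity between positions k and k' equals the ratio of expected weighted click rates: p_k / p_{k'} = E[ĉ_k^{k,k'}] / E[ĉ_{k'}^{k,k'}]. -/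
/-- If every pair in `S` is displayed at rank `k` by some ranker, then the expected weighted
click rate over `S` is the propensity times the expected relevance over `S`. -/
theorem expected_weighted_clicks {Q D : Type*} [Fintype Q]
    (Pr : Q → ℝ) (Ω : Q → Finset D) (rel : Q → D → ℝ)
    (m : ℕ) (n : Fin m → ℕ) (rnk : Fin m → Q → D → ℕ) (c : ℝ) (k : ℕ) (S : Q → D → Prop)
    (hn : ∀ i, 0 < n i) (hS : ∀ q d, S q d → ∃ i, rnk i q d = k) :
    ∑ i : Fin m, ∑ _j ∈ Finset.range (n i), ∑ q : Q, Pr q *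
        ∑ d ∈ Ω q, indR (S q d) * indR (rnk i q d = k) * (c * rel q d) / wgt m n rnk q d k
      = c * ∑ q : Q, Pr q * ∑ d ∈ Ω q, indR (S q d) * rel q d := by
  simp only [Finset.sum_const, Finset.card_range, nsmul_eq_mul, Finset.mul_sum]
  rw [Finset.sum_comm]
  refine Finset.sum_congr rfl fun q _ => ?_
  rw [Finset.sum_comm]
  refine Finset.sum_congr rfl fun d _ => ?_
  by_cases h : S q d
  · have hw := (wgt_pos hn (hS q d h)).ne'
    calc ∑ i : Fin m, (n i : ℝ) * (Pr q *
            (indR (S q d) * indR (rnk i q d = k) * (c * rel q d) / wgt m n rnk q d k))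
        = wgt m n rnk q d k *
            (Pr q * (indR (S q d) * (c * rel q d)) / wgt m n rnk q d k) := by
          conv_rhs => enter [1]; unfold wgt
          rw [Finset.sum_mul]
          exact Finset.sum_congr rfl fun i _ => by ring
      _ = c * (Pr q * (indR (S q d) * rel q d)) := by
          rw [mul_div_cancel₀ _ hw]
          ring
  · simp [indR, h]

/-- **relative propensity identity for interventional sets.** Under the
hypotheses of Proposition 3.1, if the expected interventional-set relevance
`r_{k,k'} = E_q[∑_{d ∈ Ω(q)} 1[(q,d) ∈ S_{k,k'}] · rel(q,d)]` is strictly positive and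
`p k' > 0`, then the relative propensity between positions `k` and `k'` equals the
ratio of expected weighted click rates: `p k / p k' = E[ĉ_k^{k,k'}] / E[ĉ_{k'}^{k,k'}]`. -/
theorem relative_propensity_interventional_sets {Q D : Type*} [Fintype Q]
    (Pr : Q → ℝ) (Ω : Q → Finset D) (rel : Q → D → ℝ)
    (m : ℕ) (n : Fin m → ℕ) (rnk : Fin m → Q → D → ℕ)
    (p : ℕ → ℝ) (k k' : ℕ)
    (hkk' : k ≠ k')
    (hrel : ∀ q d, rel q d = 0 ∨ rel q d = 1)
    (hp : ∀ j, 0 ≤ p j ∧ p j ≤ 1)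
    (hPr : ∀ q, 0 ≤ Pr q) (hPrsum : ∑ q : Q, Pr q = 1)
    (hn : ∀ i, 0 < n i)
    (hr : 0 < ∑ q : Q, Pr q * ∑ d ∈ Ω q, indR (Smem m rnk Ω q d k k') * rel q d)
    (hpk' : 0 < p k') :
    p k / p k'
      = (∑ i : Fin m, ∑ _j ∈ Finset.range (n i), ∑ q : Q, Pr q *
            ∑ d ∈ Ω q, indR (Smem m rnk Ω q d k k') * indR (rnk i q d = k) *
              (p k * rel q d) / wgt m n rnk q d k)
        / (∑ i : Fin m, ∑ _j ∈ Finset.range (n i), ∑ q : Q, Pr q *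
            ∑ d ∈ Ω q, indR (Smem m rnk Ω q d k k') * indR (rnk i q d = k') *
              (p k' * rel q d) / wgt m n rnk q d k') := by
  rw [expected_weighted_clicks Pr Ω rel m n rnk (p k) k
      (fun q d => Smem m rnk Ω q d k k') hn fun _ _ h => h.2.1,
    expected_weighted_clicks Pr Ω rel m n rnk (p k') k'
      (fun q d => Smem m rnk Ω q d k k') hn fun _ _ h => h.2.2,
    mul_div_mul_right _ _ hr.ne']
end

section
/- (Consistency of the PivotOne estimator at the level of expectations.) Under the hypotheses of Proposition 3.1 applied to the interventional set S_{1,k}, if r_{1,k} > 0 and p_1 > 0, then E[ĉ_k^{1,k}] / E[ĉ_1^{1,k}] = p_k / p_1; that is, the PivotOne estimator's defining ratio, evaluated at the expected values of its click counts, recovers the true relative propensity of position k with respect to position 1. -/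
/-- If every pair in `S` is placed at rank `k` by some ranker, the weighted expected click count
on `S` at position `k` is `c` times the expected relevance of `S`. -/
theorem sum_weighted_clicks {Q D : Type*} [Fintype Q]
    (Pr : Q → ℝ) (Ω : Q → Finset D) (rel : Q → D → ℝ)
    {m : ℕ} {n : Fin m → ℕ} (rnk : Fin m → Q → D → ℕ) (hn : ∀ i, 0 < n i)
    (S : Q → D → Prop) (k : ℕ) (hS : ∀ q d, S q d → ∃ i, rnk i q d = k) (c : ℝ) :
    ∑ i : Fin m, ∑ _j ∈ Finset.range (n i), ∑ q : Q, Pr q *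
        ∑ d ∈ Ω q, indR (S q d) * indR (rnk i q d = k) * (c * rel q d) / wgt m n rnk q d k
      = c * ∑ q : Q, Pr q * ∑ d ∈ Ω q, indR (S q d) * rel q d := by
  simp only [Finset.sum_const, Finset.card_range, nsmul_eq_mul, Finset.mul_sum]
  rw [Finset.sum_comm]
  refine Finset.sum_congr rfl fun q _ => ?_
  rw [Finset.sum_comm]
  refine Finset.sum_congr rfl fun d _ => ?_
  by_cases h : S q d
  · have hw := (wgt_pos hn (hS q d h)).ne'
    calc _ = ∑ i, n i * indR (rnk i q d = k) *
          (Pr q * indR (S q d) * (c * rel q d) / wgt m n rnk q d k) :=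
          Finset.sum_congr rfl fun i _ => by ring
      _ = wgt m n rnk q d k * (Pr q * indR (S q d) * (c * rel q d) / wgt m n rnk q d k) := by
          rw [← Finset.sum_mul, wgt]
      _ = _ := by rw [mul_div_cancel₀ _ hw]; ring
  · simp [indR_of_false h]

/-- **consistency of the PivotOne estimator at the level of
expectations.** Under the hypotheses of Proposition 3.1 applied to the interventional
set `S_{1,k}`, if `r_{1,k} > 0` and `p 1 > 0`, then
`E[ĉ_k^{1,k}] / E[ĉ_1^{1,k}] = p k / p 1`: the PivotOne estimator's defining ratio,
evaluated at the expected values of its click counts, recovers the true relative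
propensity of position `k` with respect to position 1. -/
theorem pivotOne_consistent_in_expectation {Q D : Type*} [Fintype Q]
    (Pr : Q → ℝ) (Ω : Q → Finset D) (rel : Q → D → ℝ)
    (m : ℕ) (n : Fin m → ℕ) (rnk : Fin m → Q → D → ℕ)
    (p : ℕ → ℝ) (k : ℕ)
    (hk : k ≠ 1)
    (hrel : ∀ q d, rel q d = 0 ∨ rel q d = 1)
    (hp : ∀ j, 0 ≤ p j ∧ p j ≤ 1)
    (hPr : ∀ q, 0 ≤ Pr q) (hPrsum : ∑ q : Q, Pr q = 1)
    (hn : ∀ i, 0 < n i)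
    (hr : 0 < ∑ q : Q, Pr q * ∑ d ∈ Ω q, indR (Smem m rnk Ω q d 1 k) * rel q d)
    (hp1 : 0 < p 1) :
    (∑ i : Fin m, ∑ _j ∈ Finset.range (n i), ∑ q : Q, Pr q *
          ∑ d ∈ Ω q, indR (Smem m rnk Ω q d 1 k) * indR (rnk i q d = k) *
            (p k * rel q d) / wgt m n rnk q d k)
      / (∑ i : Fin m, ∑ _j ∈ Finset.range (n i), ∑ q : Q, Pr q *
          ∑ d ∈ Ω q, indR (Smem m rnk Ω q d 1 k) * indR (rnk i q d = 1) *
            (p 1 * rel q d) / wgt m n rnk q d 1)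
    = p k / p 1 := by
  rw [sum_weighted_clicks Pr Ω rel rnk hn (fun q d => Smem m rnk Ω q d 1 k) k
      (fun _ _ h => h.2.2),
    sum_weighted_clicks Pr Ω rel rnk hn (fun q d => Smem m rnk Ω q d 1 k) 1
      (fun _ _ h => h.2.1)]
  exact mul_div_mul_right _ _ hr.ne'
end
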